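/- arXiv:1807.05757 — 2 statements merged into one kernel-verified Lean document; each statement's English description precedes it below -/
import Mathlib

section
/- Let A be a unital C*-algebra and let φ : A → ℂ be a faithful tracial state. Suppose that φ(p) is an integer for every projection p ∈ A. Then every idempotent e ∈ A is equal to 0 or to 1. -/
open scoped ComplexOrder

/-- In a unital C*-algebra, `1 + a* a` is invertible. -/
theorem isUnit_one_add_star_mul_self {A : Type*} [CStarAlgebra A] (a : A) :
    IsUnit (1 + star a * a) := by
  have h : (-1 : ℝ) ∉ spectrum ℝ (star a * a) := fun hmem => by
    linarith [spectrum_star_mul_self_nonneg (b := a) (-1) hmem]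
  rw [spectrum.notMem_iff] at h
  convert h.neg using 1
  simp [add_comm]

/-- Every idempotent `e` of a unital C*-algebra has a range projection `p`: a projection with
`e p = p` and `p e = e`. -/
theorem exists_isStarProjection_mul_eq_of_isIdempotentElem {A : Type*} [CStarAlgebra A] {e : A}
    (he : IsIdempotentElem e) : ∃ p : A, IsStarProjection p ∧ e * p = p ∧ p * e = e := by
  have he' : star e * star e = star e := by rw [← star_mul, he.eq]
  obtain ⟨z, hz⟩ := isUnit_one_add_star_mul_self (star e - e)
  have hz_eq : (z : A) = 1 + (e * star e - e - star e + star e * e) := by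
    rw [hz, star_sub, star_star, sub_mul, mul_sub, mul_sub, he.eq, he']
    abel
  have hez : e * z = e * star e * e := by
    rw [hz_eq]
    simp only [mul_add, mul_sub, ← mul_assoc, he.eq, mul_one]
    abel
  have hze : z * e = e * star e * e := by
    rw [hz_eq]
    simp only [add_mul, sub_mul, mul_assoc, he.eq, one_mul]
    abel
  have hz_star : star (z : A) = z := by
    rw [hz]
    simp
  have hcomm : Commute (z : A) e := hze.trans hez.symm
  have hcomm' : Commute (z : A) (e * star e) := by
    refine hcomm.mul_right ?_
    simpa only [hz_star] using hcomm.star_star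
  have hinv : Commute (↑z⁻¹ : A) (e * star e) := hcomm'.units_inv_left
  have hinv_star : star (↑z⁻¹ : A) = ↑z⁻¹ := by
    have hu : star z = z := Units.ext hz_star
    rw [← Units.coe_star, star_inv, hu]
  have hpe : e * star e * ↑z⁻¹ * e = e := by
    rw [← hinv.eq, mul_assoc, ← hze, Units.inv_mul_cancel_left]
  refine ⟨e * star e * ↑z⁻¹, ⟨?_, ?_⟩, ?_, hpe⟩
  · change e * star e * ↑z⁻¹ * (e * star e * ↑z⁻¹) = _
    simp only [← mul_assoc]
    rw [hpe]
  · change star _ = _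
    simp [hinv_star, hinv.eq]
  · simp only [← mul_assoc, he.eq]

/-- Let `A` be a unital C*-algebra and `φ : A → ℂ` a faithful tracial state.
If `φ(p)` is an integer for every projection `p ∈ A`, then every idempotent `e ∈ A`
equals `0` or `1`. -/
theorem trace_integer_on_projections_implies_no_nontrivial_idempotents
    {A : Type*} [NormedRing A] [StarRing A] [CStarRing A] [CompleteSpace A]
    [NormedAlgebra ℂ A] [StarModule ℂ A]
    (φ : A →ₗ[ℂ] ℂ)
    (hpos : ∀ a : A, 0 ≤ φ (star a * a))
    (hone : φ 1 = 1)
    (htrace : ∀ a b : A, φ (a * b) = φ (b * a))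
    (hfaithful : ∀ a : A, φ (star a * a) = 0 → a = 0)
    (hint : ∀ p : A, star p = p → p * p = p → ∃ n : ℤ, φ p = (n : ℂ)) :
    ∀ e : A, e * e = e → e = 0 ∨ e = 1 := by
  let _ : CStarAlgebra A := {}
  intro e he
  obtain ⟨p, hp, hep, hpe⟩ := exists_isStarProjection_mul_eq_of_isIdempotentElem he
  have eq_zero_of_trace (q : A) (hq : IsStarProjection q) (h : φ q = 0) : q = 0 :=
    hfaithful q (by rw [hq.isSelfAdjoint.star_eq, hq.isIdempotentElem.eq, h])
  have trace_nonneg (q : A) (hq : IsStarProjection q) : 0 ≤ φ q := by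
    simpa only [hq.isSelfAdjoint.star_eq, hq.isIdempotentElem.eq] using hpos q
  obtain ⟨n, hn⟩ := hint p hp.isSelfAdjoint.star_eq hp.isIdempotentElem.eq
  have h0 : 0 ≤ n := by
    have h := trace_nonneg p hp
    rw [hn] at h
    exact_mod_cast h
  have h1 : n ≤ 1 := by
    have h := trace_nonneg _ hp.one_sub
    rw [map_sub, hone, hn, sub_nonneg] at h
    exact_mod_cast h
  obtain rfl | rfl : n = 0 ∨ n = 1 := by lia
  · left
    rw [← hpe, eq_zero_of_trace p hp (by simpa using hn), zero_mul]
  · right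
    have hp1 : p = 1 :=
      (sub_eq_zero.mp (eq_zero_of_trace _ hp.one_sub (by simp [hone, hn]))).symm
    simpa [hp1] using hep
end

section
/- Let X be a compact Hausdorff space and let K₁, K₂, …, K_l be finitely many closed subsets of X. Then there exists a finite open cover 𝔘 of X such that for every U ∈ 𝔘 and every nonempty subset I ⊆ {1, 2, …, l}, if U ∩ K_i ≠ ∅ for all i ∈ I, then ⋂_{i∈I} K_i ≠ ∅. -/
/-- Lemma 3.9 of the paper. Let `X` be a compact Hausdorff space and
`K₁, …, K_l` finitely many closed subsets. Then there is a finite open cover `𝔘` of `X` such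
that for every `U ∈ 𝔘` and every nonempty `I ⊆ {1, …, l}`, if `U ∩ K i ≠ ∅` for all `i ∈ I`,
then `⋂ i ∈ I, K i ≠ ∅`. -/
theorem exists_finite_open_cover_detecting_intersections
    {X : Type*} [TopologicalSpace X] [CompactSpace X] [T2Space X]
    {l : ℕ} (K : Fin l → Set X) (hK : ∀ i, IsClosed (K i)) :
    ∃ 𝔘 : Finset (Set X),
      (∀ U ∈ 𝔘, IsOpen U) ∧
      ⋃₀ (𝔘 : Set (Set X)) = Set.univ ∧
      ∀ U ∈ 𝔘, ∀ I : Finset (Fin l), I.Nonempty →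
        (∀ i ∈ I, (U ∩ K i).Nonempty) → (⋂ i ∈ I, K i).Nonempty := by
  -- the points avoiding every `K i` that avoids `x`
  let U : X → Set X := fun x => ⋂ i ∈ {i | x ∉ K i}, (K i)ᶜ
  have hfin : (Set.range U).Finite :=
    (Set.finite_range fun s : Set (Fin l) => ⋂ i ∈ s, (K i)ᶜ).subset
      (Set.range_subset_iff.2 fun x => ⟨{i | x ∉ K i}, rfl⟩)
  refine ⟨hfin.toFinset, ?_, ?_, ?_⟩
  · intro V hV
    obtain ⟨x, rfl⟩ := hfin.mem_toFinset.1 hV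
    exact (Set.toFinite _).isOpen_biInter fun i _ => (hK i).isOpen_compl
  · rw [hfin.coe_toFinset]
    exact Set.eq_univ_of_forall fun x => ⟨U x, ⟨x, rfl⟩, Set.mem_iInter₂.2 fun _ hi => hi⟩
  · intro V hV I _ h
    obtain ⟨x, rfl⟩ := hfin.mem_toFinset.1 hV
    refine ⟨x, Set.mem_iInter₂.2 fun i hi => ?_⟩
    obtain ⟨y, hyU, hyK⟩ := h i hi
    by_contra hx
    exact Set.mem_iInter₂.1 hyU i hx hyK
end
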